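/- Let l1, l2, m1, m2 be positive reals, set l3 = l2, m3 = m2 and c = 0. Then at every point of the set M = {(γ1, γ2, π1, π2) : γ2 = −2γ1, π1 = 0} the partial derivatives of the reduced Hamiltonian H satisfy ∂H/∂γ1 = 0, ∂H/∂γ2 = 0, ∂H/∂π1 = −π2/(l2²*m2) and ∂H/∂π2 = 2π2/(l2²*m2). Consequently M is invariant under the Hamiltonian flow of H, and on M one has γ̇1 = −π2/(l2²*m2) with π2 constant. -/

import Mathlib

/-- The reduced flail-pendulum Hamiltonian in the variables `(γ1, γ2, p1, p2)`. -/
noncomputable def flailH (l1 l2 l3 m1 m2 m3 c : ℝ) (γ1 γ2 p1 p2 : ℝ) : ℝ :=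
  (l1 ^ 2 * (m1 + m2 + m3) * (l3 ^ 2 * m3 * (p1 - p2) ^ 2 + l2 ^ 2 * m2 * p2 ^ 2)
      + l2 ^ 2 * l3 ^ 2 * m2 * m3 * (p1 - c) ^ 2
      - l1 * (l1 * l2 ^ 2 * m2 ^ 2 * p2 ^ 2 * Real.cos γ1 ^ 2
          + l3 * m3 * Real.cos (γ1 + γ2) *
              (2 * l2 ^ 2 * m2 * p2 * (c - p1)
                + l1 * l3 * m3 * (p1 - p2) ^ 2 * Real.cos (γ1 + γ2))
          - 2 * l2 * l3 * m2 * m3 * (p1 - p2) * Real.cos γ1 *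
              (l3 * (p1 - c) + l1 * p2 * Real.cos (γ1 + γ2)))) /
    (2 * l1 ^ 2 * l2 ^ 2 * l3 ^ 2 * m2 * m3 *
      ((m1 + m2 + m3) - m2 * Real.cos γ1 ^ 2 - m3 * Real.cos (γ1 + γ2) ^ 2))

theorem flail_B_pos (m1 m2 x y : ℝ) (hm1 : 0 < m1) (hm2 : 0 < m2) :
    0 < (m1 + m2 + m2) - m2 * Real.cos x ^ 2 - m2 * Real.cos y ^ 2 := by
  have h1 := Real.cos_sq_le_one x
  have h2 := Real.cos_sq_le_one y
  nlinarith

theorem flail_zero (l1 l2 m1 m2 : ℝ)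
    (hl1 : 0 < l1) (hl2 : 0 < l2) (hm1 : 0 < m1) (hm2 : 0 < m2) (x y p : ℝ) :
    flailH l1 l2 l2 m1 m2 m2 0 x y 0 p = p ^ 2 / (l2 ^ 2 * m2) +
      (Real.cos x - Real.cos (x + y)) ^ 2 * (p ^ 2 / (2 * l2 ^ 2 *
        ((m1 + m2 + m2) - m2 * Real.cos x ^ 2 - m2 * Real.cos (x + y) ^ 2))) := by
  have hB := (flail_B_pos m1 m2 x (x + y) hm1 hm2).ne'
  unfold flailH
  generalize Real.cos x = a at *
  generalize Real.cos (x + y) = b at *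
  generalize hBd : (m1 + m2 + m2) - m2 * a ^ 2 - m2 * b ^ 2 = B at *
  have : m1 = B - m2 - m2 + m2 * a ^ 2 + m2 * b ^ 2 := by linarith
  subst this
  field_simp
  ring

theorem flail_sq_mul (u v : ℝ → ℝ) (C x : ℝ) (hu : DifferentiableAt ℝ u x)
    (hv : DifferentiableAt ℝ v x) (h0 : u x = 0) :
    deriv (fun s => C + u s ^ 2 * v s) x = 0 := by
  have h := ((hu.hasDerivAt.pow 2).mul hv.hasDerivAt).const_add C
  refine (h.congr_deriv ?_).deriv
  simp [h0]

theorem flail_partials (l1 l2 m1 m2 : ℝ)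
    (hl1 : 0 < l1) (hl2 : 0 < l2) (hm1 : 0 < m1) (hm2 : 0 < m2) (x p : ℝ) :
    deriv (fun s => flailH l1 l2 l2 m1 m2 m2 0 s (-2 * x) 0 p) x = 0 ∧
    deriv (fun s => flailH l1 l2 l2 m1 m2 m2 0 x s 0 p) (-2 * x) = 0 ∧
    deriv (fun s => flailH l1 l2 l2 m1 m2 m2 0 x (-2 * x) s p) 0 = -p / (l2 ^ 2 * m2) ∧
    deriv (fun s => flailH l1 l2 l2 m1 m2 m2 0 x (-2 * x) 0 s) p = 2 * p / (l2 ^ 2 * m2) := by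
  have hx : Real.cos (x + -2 * x) = Real.cos x := by
    rw [← Real.cos_neg x]; congr 1; ring
  have hden : ∀ y z : ℝ, 2 * l2 ^ 2 *
      ((m1 + m2 + m2) - m2 * Real.cos y ^ 2 - m2 * Real.cos z ^ 2) ≠ 0 := fun y z =>
    mul_ne_zero (by positivity) (flail_B_pos m1 m2 y z hm1 hm2).ne'
  refine ⟨?_, ?_, ?_, ?_⟩
  · simp only [flail_zero l1 l2 m1 m2 hl1 hl2 hm1 hm2]
    refine flail_sq_mul (fun s => Real.cos s - Real.cos (s + -2 * x)) _ _ _ (by fun_prop) ?_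
      (by simp only [hx, sub_self])
    exact DifferentiableAt.div (by fun_prop) (by fun_prop) (hden _ _)
  · simp only [flail_zero l1 l2 m1 m2 hl1 hl2 hm1 hm2]
    refine flail_sq_mul (fun s => Real.cos x - Real.cos (x + s)) _ _ _ (by fun_prop) ?_
      (by simp only [hx, sub_self])
    exact DifferentiableAt.div (by fun_prop) (by fun_prop) (hden _ _)
  · have hB := (flail_B_pos m1 m2 x x hm1 hm2).ne'
    have key : ∃ K : ℝ, (fun s => flailH l1 l2 l2 m1 m2 m2 0 x (-2 * x) s p) =
        fun s => p ^ 2 / (l2 ^ 2 * m2) + s * (-p / (l2 ^ 2 * m2)) + s ^ 2 * K := by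
      refine ⟨(l1 ^ 2 * (m1 + m2 + m2) * l2 ^ 2 * m2 + l2 ^ 4 * m2 ^ 2
        - l1 ^ 2 * l2 ^ 2 * m2 ^ 2 * Real.cos x ^ 2 + 2 * l1 * l2 ^ 3 * m2 ^ 2 * Real.cos x) /
        (2 * l1 ^ 2 * l2 ^ 4 * m2 ^ 2 *
          ((m1 + m2 + m2) - m2 * Real.cos x ^ 2 - m2 * Real.cos x ^ 2)), ?_⟩
      funext s
      unfold flailH
      rw [hx]
      generalize Real.cos x = a at *
      generalize hBd : (m1 + m2 + m2) - m2 * a ^ 2 - m2 * a ^ 2 = B at *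
      have : m1 = B - m2 - m2 + m2 * a ^ 2 + m2 * a ^ 2 := by linarith
      subst this
      field_simp
      ring
    obtain ⟨K, hK⟩ := key
    rw [hK]
    have h := (((hasDerivAt_id (0 : ℝ)).mul_const (-p / (l2 ^ 2 * m2))).const_add
      (p ^ 2 / (l2 ^ 2 * m2))).add (((hasDerivAt_id (0 : ℝ)).pow 2).mul_const K)
    refine (h.congr_deriv ?_).deriv
    simp
  · simp only [flail_zero l1 l2 m1 m2 hl1 hl2 hm1 hm2, hx, sub_self]
    have h := ((hasDerivAt_id p).pow 2).div_const (l2 ^ 2 * m2)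
    have h2 : HasDerivAt (fun s : ℝ => s ^ 2 / (l2 ^ 2 * m2)) (2 * p / (l2 ^ 2 * m2)) p := by
      refine h.congr_deriv ?_
      simp
    simpa using h2.deriv

/-- With `l3 = l2`, `m3 = m2`, `c = 0`, on the set `M = {γ2 = -2γ1, p1 = 0}` the partial
derivatives of the reduced Hamiltonian take the indicated values; consequently `M` is invariant
under the Hamiltonian flow and on `M` one has `γ̇1 = -p2/(l2² m2)` with `p2` constant. -/
theorem stmt_1 (l1 l2 m1 m2 : ℝ)
    (hl1 : 0 < l1) (hl2 : 0 < l2) (hm1 : 0 < m1) (hm2 : 0 < m2)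
    (H : ℝ → ℝ → ℝ → ℝ → ℝ) (hH : H = flailH l1 l2 l2 m1 m2 m2 0) :
    (∀ γ1 p2 : ℝ,
      deriv (fun s => H s (-2 * γ1) 0 p2) γ1 = 0 ∧
      deriv (fun s => H γ1 s 0 p2) (-2 * γ1) = 0 ∧
      deriv (fun s => H γ1 (-2 * γ1) s p2) 0 = -p2 / (l2 ^ 2 * m2) ∧
      deriv (fun s => H γ1 (-2 * γ1) 0 s) p2 = 2 * p2 / (l2 ^ 2 * m2))
    ∧
    -- the curve `t ↦ (γ1 t, -2 γ1 t, 0, p2)` with `γ1 t = γ1 0 - p2 t/(l2² m2)` solves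
    -- Hamilton's equations: `M` is invariant, `γ̇1 = -p2/(l2² m2)` and `p2` is constant
    (∀ γ10 p2 t : ℝ,
      HasDerivAt (fun τ => γ10 - p2 * τ / (l2 ^ 2 * m2))
        (deriv (fun s => H (γ10 - p2 * t / (l2 ^ 2 * m2))
            (-2 * (γ10 - p2 * t / (l2 ^ 2 * m2))) s p2) 0) t ∧
      HasDerivAt (fun τ => -2 * (γ10 - p2 * τ / (l2 ^ 2 * m2)))
        (deriv (fun s => H (γ10 - p2 * t / (l2 ^ 2 * m2))
            (-2 * (γ10 - p2 * t / (l2 ^ 2 * m2))) 0 s) p2) t ∧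
      HasDerivAt (fun _ : ℝ => (0 : ℝ))
        (-(deriv (fun s => H s (-2 * (γ10 - p2 * t / (l2 ^ 2 * m2))) 0 p2)
          (γ10 - p2 * t / (l2 ^ 2 * m2)))) t ∧
      HasDerivAt (fun _ : ℝ => p2)
        (-(deriv (fun s => H (γ10 - p2 * t / (l2 ^ 2 * m2)) s 0 p2)
          (-2 * (γ10 - p2 * t / (l2 ^ 2 * m2))))) t) := by
  subst hH
  have hP := flail_partials l1 l2 m1 m2 hl1 hl2 hm1 hm2
  refine ⟨hP, fun γ10 p2 t => ?_⟩
  obtain ⟨h1, h2, h3, h4⟩ := hP (γ10 - p2 * t / (l2 ^ 2 * m2)) p2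
  rw [h1, h2, h3, h4]
  have h : HasDerivAt (fun τ => γ10 - p2 * τ / (l2 ^ 2 * m2)) (-p2 / (l2 ^ 2 * m2)) t := by
    refine ((((hasDerivAt_id t).const_mul p2).div_const (l2 ^ 2 * m2)).const_sub γ10).congr_deriv ?_
    ring
  refine ⟨h, (h.const_mul (-2)).congr_deriv (by ring), ?_, ?_⟩
  · simpa using hasDerivAt_const t (0 : ℝ)
  · simpa using hasDerivAt_const t p2
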